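/- arXiv:2407.12218 — 2 statements merged into one kernel-verified Lean document; each statement's English description precedes it below -/
import Mathlib

section
/- For every n ≥ 0, the sum of JD(T) over all full binary trees T with V(T) = n satisfies (n + 2)·Σ_{V(T)=n} JD(T) = n·(n − 1)·b_n; equivalently, the expected sum of jump distances among all full binary trees with n internal vertices is n(n−1)/(n+2). -/
inductive BTree : Type
  | leaf : BTree
  | node : BTree → BTree → BTree

namespace BTree

/-- number of internal vertices -/
def V : BTree → ℕ
  | leaf => 0
  | node l r => V l + V r + 1

/-- depth of the rightmost leaf -/
def D : BTree → ℕ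
  | leaf => 0
  | node _ r => 1 + D r

/-- number of jumps -/
def J : BTree → ℕ
  | leaf => 0
  | node leaf r => J r
  | node (node l₁ r₁) r => J (node l₁ r₁) + J r + 1

/-- sum of jump distances -/
def JD : BTree → ℕ
  | leaf => 0
  | node l r => JD l + JD r + D l

end BTree

namespace BTree

theorem finite_V (n : ℕ) : {T : BTree | T.V = n}.Finite := by
  induction n using Nat.strong_induction_on with
  | _ n ih =>
    have hf : ({BTree.leaf} ∪ Set.image2 BTree.node (⋃ i ∈ Set.Iio n, {T : BTree | T.V = i})
        (⋃ i ∈ Set.Iio n, {T : BTree | T.V = i})).Finite := by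
      have h1 : (⋃ i ∈ Set.Iio n, {T : BTree | T.V = i}).Finite :=
        Set.Finite.biUnion (Set.finite_Iio n) (fun i hi => ih i hi)
      exact (Set.finite_singleton _).union (h1.image2 _ h1)
    refine hf.subset ?_
    intro T hT
    cases T with
    | leaf => left; rfl
    | node l r =>
      right
      simp only [Set.mem_ofPred_eq, V] at hT
      refine ⟨l, ?_, r, ?_, rfl⟩ <;> simp <;> omega

/-- the finset of trees with n internal vertices -/
noncomputable def S (n : ℕ) : Finset BTree := (finite_V n).toFinset

theorem mem_S {n : ℕ} {T : BTree} : T ∈ S n ↔ T.V = n := by simp [S]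

theorem S_zero : S 0 = {leaf} := by
  ext T
  rw [mem_S]
  cases T <;> simp [V]

theorem sum_S_succ (f : BTree → ℚ) (n : ℕ) :
    ∑ T ∈ S (n + 1), f T =
      ∑ p ∈ Finset.HasAntidiagonal.antidiagonal n, ∑ l ∈ S p.1, ∑ r ∈ S p.2, f (node l r) := by
  simp_rw [← Finset.sum_product']
  rw [Finset.sum_sigma']
  symm
  refine Finset.sum_bij (fun x _ => node x.2.1 x.2.2) ?_ ?_ ?_ ?_
  · rintro ⟨⟨a, b⟩, l, r⟩ h
    simp only [Finset.mem_sigma, Finset.HasAntidiagonal.mem_antidiagonal, Finset.mem_product, mem_S] at h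
    simp only [mem_S, V]
    omega
  · rintro ⟨⟨a, b⟩, l, r⟩ h ⟨⟨a', b'⟩, l', r'⟩ h' he
    simp only [Finset.mem_sigma, Finset.HasAntidiagonal.mem_antidiagonal, Finset.mem_product, mem_S] at h h'
    simp only [node.injEq] at he
    obtain ⟨rfl, rfl⟩ := he
    obtain ⟨_, rfl, rfl⟩ := h
    obtain ⟨_, rfl, rfl⟩ := h'
    rfl
  · intro T hT
    rw [mem_S] at hT
    cases T with
    | leaf => simp [V] at hT
    | node l r =>
      simp only [V] at hT
      refine ⟨⟨(l.V, r.V), l, r⟩, ?_, rfl⟩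
      simp only [Finset.mem_sigma, Finset.HasAntidiagonal.mem_antidiagonal, Finset.mem_product, mem_S]
      exact ⟨by omega, trivial, trivial⟩
  · intros; rfl

/-- generating series of a statistic -/
noncomputable def gf (f : BTree → ℚ) : PowerSeries ℚ := PowerSeries.mk fun n => ∑ T ∈ S n, f T

theorem gf_add (f g : BTree → ℚ) : gf (fun T => f T + g T) = gf f + gf g := by
  ext n; simp [gf, Finset.sum_add_distrib]

theorem gf_node (f : BTree → ℚ) (g h g' h' g'' h'' : BTree → ℚ)
    (hf : ∀ l r, f (node l r) = g l * h r + g' l * h' r + g'' l * h'' r) :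
    gf f = PowerSeries.C (f leaf) +
      PowerSeries.X * (gf g * gf h + gf g' * gf h' + gf g'' * gf h'') := by
  ext n
  cases n with
  | zero => simp [gf, S_zero]
  | succ n =>
    rw [map_add, PowerSeries.coeff_succ_X_mul, map_add, map_add, PowerSeries.coeff_mul,
      PowerSeries.coeff_mul, PowerSeries.coeff_mul]
    simp only [gf, PowerSeries.coeff_mk, PowerSeries.coeff_C, sum_S_succ, hf,
      Finset.sum_add_distrib, Finset.sum_mul_sum]
    simp

theorem gf_zero : gf (fun _ => 0) = 0 := by
  ext n; simp [gf]

theorem C_eq : gf (fun _ => 1) = 1 + PowerSeries.X * (gf (fun _ => 1) * gf (fun _ => 1)) := by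
  have := gf_node (fun _ => 1) (fun _ => 1) (fun _ => 1) (fun _ => 0) (fun _ => 0)
    (fun _ => 0) (fun _ => 0) (by simp)
  simpa [gf_zero] using this

theorem D_eq : gf (fun T => (T.D : ℚ)) = PowerSeries.X * (gf (fun _ => 1) * gf (fun _ => 1)
    + gf (fun _ => 1) * gf (fun T => (T.D : ℚ))) := by
  have := gf_node (fun T => (T.D : ℚ)) (fun _ => 1) (fun _ => 1) (fun _ => 1)
    (fun T => (T.D : ℚ)) (fun _ => 0) (fun _ => 0) (by simp [D])
  simpa [gf_zero, D] using this

theorem JD_eq : gf (fun T => (T.JD : ℚ)) =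
    PowerSeries.X * (gf (fun T => (T.JD : ℚ)) * gf (fun _ => 1)
    + gf (fun _ => 1) * gf (fun T => (T.JD : ℚ))
    + gf (fun T => (T.D : ℚ)) * gf (fun _ => 1)) := by
  have := gf_node (fun T => (T.JD : ℚ)) (fun T => (T.JD : ℚ)) (fun _ => 1) (fun _ => 1)
    (fun T => (T.JD : ℚ)) (fun T => (T.D : ℚ)) (fun _ => 1) (by simp [JD])
  simpa [JD] using this

theorem card_S (n : ℕ) : (S n).card = catalan n := by
  induction n using Nat.strong_induction_on with
  | _ n ih =>
    cases n with
    | zero => simp [S_zero]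
    | succ n =>
      have h := sum_S_succ (fun _ => 1) n
      rw [catalan_succ']
      simp only [Finset.sum_const, nsmul_eq_mul, mul_one] at h
      have h2 : (S (n+1)).card = ∑ p ∈ Finset.HasAntidiagonal.antidiagonal n, (S p.1).card * (S p.2).card := by
        exact_mod_cast h
      rw [h2]
      refine Finset.sum_congr rfl fun p hp => ?_
      rw [Finset.HasAntidiagonal.mem_antidiagonal] at hp
      rw [ih _ (by omega), ih _ (by omega)]

theorem C_cat : gf (fun _ => 1) = PowerSeries.mk fun n => (catalan n : ℚ) := by
  ext n; simp [gf, card_S]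

/-- central binomial series -/
noncomputable def B : PowerSeries ℚ := PowerSeries.mk fun n => (n.centralBinom : ℚ)

theorem B_eq : B = 1 + 2 * PowerSeries.X * B * gf (fun _ => 1) := by
  rw [show 1 + 2 * PowerSeries.X * B * gf (fun _ => 1)
    = 1 + PowerSeries.X * (B * gf (fun _ => 1) + gf (fun _ => 1) * B) by ring, C_cat]
  ext n
  cases n with
  | zero => simp [B]
  | succ n =>
    rw [map_add, PowerSeries.coeff_succ_X_mul, map_add, PowerSeries.coeff_mul,
      PowerSeries.coeff_mul, ← Finset.sum_add_distrib]
    simp only [B, PowerSeries.coeff_mk, PowerSeries.coeff_one, ← succ_mul_catalan_eq_centralBinom]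
    rw [catalan_succ']
    push_cast
    simp only [Nat.add_eq_zero_iff, one_ne_zero, and_false, if_false, zero_add]
    rw [Finset.mul_sum]
    refine Finset.sum_congr rfl fun p hp => ?_
    rw [Finset.HasAntidiagonal.mem_antidiagonal] at hp
    have : (n : ℚ) = p.1 + p.2 := by exact_mod_cast hp.symm
    rw [this]; ring

theorem JD_formula : 2 * (PowerSeries.X * (PowerSeries.X * gf (fun T => (T.JD : ℚ)))) =
    B - 1 - 4 * (PowerSeries.X * B) + 2 * PowerSeries.X
      + 2 * (PowerSeries.X * (PowerSeries.X * B)) := by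
  have hC := C_eq
  have hD := D_eq
  have hJ := JD_eq
  have hB := B_eq
  generalize gf (fun _ => 1) = C at *
  generalize gf (fun T => (T.D : ℚ)) = d at *
  generalize gf (fun T => (T.JD : ℚ)) = j at *
  generalize B = b at *
  generalize (PowerSeries.X : PowerSeries ℚ) = x at *
  have hd : d = C * (C - 1) := by
    linear_combination C * hD - (d + C) * hC
  have hj : j = b * (C - 1) ^ 2 := by
    linear_combination b * hJ - j * hB + b * x * C * hd - b * (C - 1) * hC
  linear_combination 2 * x ^ 2 * hj - 2 * x * b * hC - (1 - 2 * x) * hB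

theorem coeff_formula (n : ℕ) : 2 * ∑ T ∈ S n, (T.JD : ℚ) =
    ((n+2).centralBinom : ℚ) - 4 * ((n+1).centralBinom : ℚ) + 2 * (n.centralBinom : ℚ) := by
  have h := congrArg (PowerSeries.coeff (n + 2)) JD_formula
  have e2 : (2 : PowerSeries ℚ) = PowerSeries.C 2 := (map_ofNat _ 2).symm
  have e4 : (4 : PowerSeries ℚ) = PowerSeries.C 4 := (map_ofNat _ 4).symm
  rw [e2, e4] at h
  simp only [map_add, map_sub, PowerSeries.coeff_C_mul, PowerSeries.coeff_succ_X_mul,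
    PowerSeries.coeff_X, PowerSeries.coeff_one] at h
  simpa [gf, B] using h

end BTree

/-- The expected sum of jump distances among full binary trees with n internal
vertices is n(n−1)/(n+2): (n + 2)·Σ JD(T) = n·(n − 1)·bₙ. -/
theorem stmt_14 (n : ℕ) :
    ((n : ℚ) + 2) * (∑ᶠ T ∈ {T : BTree | T.V = n}, (T.JD : ℚ)) =
      (n : ℚ) * ((n : ℚ) - 1) * (Nat.card {T : BTree // T.V = n} : ℚ) := by
  have h1 : Nat.card {T : BTree // T.V = n} = catalan n := by
    rw [← BTree.card_S, BTree.S, ← Set.ncard_eq_toFinset_card _ (BTree.finite_V n)]; rfl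
  rw [h1, finsum_mem_eq_finite_toFinset_sum _ (BTree.finite_V n)]
  have h2 := BTree.coeff_formula n
  rw [BTree.S] at h2
  have h3 : ((n : ℚ) + 1) * catalan n = n.centralBinom := by
    exact_mod_cast succ_mul_catalan_eq_centralBinom n
  have h4 : ((n : ℚ) + 1) * (n+1).centralBinom = 2 * (2 * n + 1) * n.centralBinom := by
    exact_mod_cast Nat.succ_mul_centralBinom_succ n
  have h5 : ((n : ℚ) + 1 + 1) * (n+2).centralBinom
      = 2 * (2 * (n + 1) + 1) * (n+1).centralBinom := by
    exact_mod_cast Nat.succ_mul_centralBinom_succ (n+1)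
  have hn : (n : ℚ) + 1 ≠ 0 := by positivity
  apply mul_left_cancel₀ hn
  linear_combination ((n:ℚ)+1)*(n+2)/2 * h2 - n*(n-1) * h3 + (n+1)/2 * h5 - h4
end

section
/- For every n ≥ 1, let ν_k = (1/b_n)·Σ_{V(T)=n} (JD(T) − n(n−1)/(n+2))^k ∈ ℚ be the k-th central moment of the sum-of-jump-distances statistic over the uniform distribution on full binary trees with n internal vertices. Then 2n·(2n⁴ + 17n³ + 30n² − 29n − 20)·ν_4 = (25n⁵ + 58n⁴ − 45n³ − 34n² − 172n − 48)·ν_2²; equivalently, whenever ν_2 ≠ 0, the kurtosis ν_4/ν_2² equals (25n⁵ + 58n⁴ − 45n³ − 34n² − 172n − 48)/(2n·(2n⁴ + 17n³ + 30n² − 29n − 20)). -/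
namespace BTree

open Finset

theorem JD_add_D (T : BTree) : T.JD + T.D = T.V := by
  induction T with
  | leaf => rfl
  | node l r hl hr => simp only [JD, D, V]; omega

def toB : BTree → BinaryTree Unit
  | leaf => .nil
  | node l r => .node () (toB l) (toB r)

def ofB : BinaryTree Unit → BTree
  | .nil => leaf
  | .node _ l r => node (ofB l) (ofB r)

theorem ofB_toB (T : BTree) : ofB (toB T) = T := by
  induction T with
  | leaf => rfl
  | node l r hl hr => simp only [toB, ofB, hl, hr]

theorem toB_ofB (T : BinaryTree Unit) : toB (ofB T) = T := by
  induction T with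
  | nil => rfl
  | node _ l r hl hr => simp only [toB, ofB, hl, hr]

theorem V_ofB (T : BinaryTree Unit) : (ofB T).V = T.numNodes := by
  induction T with
  | nil => rfl
  | node _ l r hl hr => simp only [V, ofB, hl, hr, BinaryTree.numNodes]

/-- The trees with `n` internal vertices, as a finset. -/
def trees (n : ℕ) : Finset BTree :=
  (BinaryTree.treesOfNumNodesEq n).map
    ⟨ofB, Function.LeftInverse.injective toB_ofB⟩

theorem mem_trees (n : ℕ) (T : BTree) : T ∈ trees n ↔ T.V = n := by
  simp only [trees, Finset.mem_map, Function.Embedding.coeFn_mk,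
    BinaryTree.mem_treesOfNumNodesEq]
  constructor
  · rintro ⟨S, hS, rfl⟩
    rw [V_ofB, hS]
  · intro h
    refine ⟨toB T, ?_, ofB_toB T⟩
    rw [← V_ofB, ofB_toB, h]

/-- Sum of a function of the depth over the trees with `n` internal vertices. -/
def W (n : ℕ) (f : ℕ → ℚ) : ℚ := ∑ T ∈ trees n, f T.D

theorem W_one (n : ℕ) : W n (fun _ => 1) = (catalan n : ℚ) := by
  simp [W, trees, BinaryTree.treesOfNumNodesEq_card_eq_catalan]

theorem W_zero (f : ℕ → ℚ) : W 0 f = f 0 := by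
  simp [W, trees, ofB, D]

theorem W_succ (n : ℕ) (f : ℕ → ℚ) :
    W (n + 1) f = ∑ ij ∈ antidiagonal n, (catalan ij.1 : ℚ) * W ij.2 (fun d => f (d + 1)) := by
  rw [W, trees, Finset.sum_map, BinaryTree.treesOfNumNodesEq_succ, Finset.sum_biUnion]
  · apply Finset.sum_congr rfl
    rintro ⟨i, j⟩ -
    rw [Finset.sum_map, Finset.sum_product]
    trans ∑ _x ∈ BinaryTree.treesOfNumNodesEq i,
      ∑ y ∈ BinaryTree.treesOfNumNodesEq j, f (1 + (ofB y).D)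
    · rfl
    simp only [W, trees, Finset.sum_map, Function.Embedding.coeFn_mk]
    rw [Finset.sum_const, BinaryTree.treesOfNumNodesEq_card_eq_catalan, nsmul_eq_mul]
    simp only [add_comm]
  · simp_rw [Set.PairwiseDisjoint, Set.Pairwise, disjoint_left]
    aesop

theorem W_add (n : ℕ) (f g : ℕ → ℚ) : W n (fun d => f d + g d) = W n f + W n g :=
  Finset.sum_add_distrib

theorem W_mul (n : ℕ) (a : ℚ) (f : ℕ → ℚ) : W n (fun d => a * f d) = a * W n f :=
  (Finset.mul_sum _ _ _).symm

/-- The generating-tree rule. -/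
theorem W_step (n : ℕ) : ∀ f : ℕ → ℚ,
    W (n + 1) f = W n (fun d => ∑ i ∈ range (d + 1), f (i + 1)) := by
  induction n using Nat.strong_induction_on with
  | _ n ih =>
    intro f
    cases n with
    | zero => simp [W_succ, W_zero]
    | succ n =>
      have key : ∀ d, ∑ i ∈ range (d + 1 + 1), f (i + 1)
          = f 1 * 1 + ∑ i ∈ range (d + 1), f (i + 1 + 1) := by
        intro d
        rw [Finset.sum_range_succ']; ring
      have h1 := W_succ n (fun _ => 1)
      rw [W_one] at h1
      rw [W_succ, W_succ n, Finset.Nat.sum_antidiagonal_succ']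
      simp only [key, W_add, W_mul, W_zero, mul_add, Finset.sum_add_distrib]
      rw [h1]
      congr 1
      · rw [Finset.sum_mul]
        exact Finset.sum_congr rfl fun _ _ => by ring
      · apply Finset.sum_congr rfl
        rintro ⟨i, j⟩ hij
        rw [ih j (by have := mem_antidiagonal.1 hij; simp at this; omega)]

/-- Raw moments. -/
def m (k n : ℕ) : ℚ := W n (fun d => (d : ℚ) ^ k)

theorem m_zero (n : ℕ) : m 0 n = catalan n := by
  simpa [m] using W_one n

theorem m0_succ (n : ℕ) : m 0 (n + 1) = m 1 n + m 0 n := by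
  simp only [m, W_step n, ← W_add]
  congr 1; funext d
  induction d with
  | zero => simp
  | succ d ih => rw [Finset.sum_range_succ, ih]; push_cast; ring

theorem m1_succ (n : ℕ) : m 1 (n + 1) = (1/2) * m 2 n + (3/2) * m 1 n + m 0 n := by
  simp only [m, W_step n, ← W_add, ← W_mul]
  congr 1; funext d
  induction d with
  | zero => simp
  | succ d ih => rw [Finset.sum_range_succ, ih]; push_cast; ring

theorem m2_succ (n : ℕ) :
    m 2 (n + 1) = (1/3) * m 3 n + (3/2) * m 2 n + (13/6) * m 1 n + m 0 n := by
  simp only [m, W_step n, ← W_add, ← W_mul]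
  congr 1; funext d
  induction d with
  | zero => simp
  | succ d ih => rw [Finset.sum_range_succ, ih]; push_cast; ring

theorem m3_succ (n : ℕ) :
    m 3 (n + 1) = (1/4) * m 4 n + (3/2) * m 3 n + (13/4) * m 2 n + 3 * m 1 n + m 0 n := by
  simp only [m, W_step n, ← W_add, ← W_mul]
  congr 1; funext d
  induction d with
  | zero => simp
  | succ d ih => rw [Finset.sum_range_succ, ih]; push_cast; ring

theorem catalan_step (n : ℕ) :
    (catalan (n + 1) : ℚ) = 2 * (2 * n + 1) / (n + 2) * catalan n := by
  have h1 := succ_mul_catalan_eq_centralBinom n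
  have h2 := succ_mul_catalan_eq_centralBinom (n + 1)
  have h3 := Nat.succ_mul_centralBinom_succ n
  rw [← h1, ← h2] at h3
  have h4 : ((n : ℚ) + 1) * ((n + 1 + 1) * catalan (n + 1))
      = 2 * (2 * n + 1) * ((n + 1) * catalan n) := by exact_mod_cast h3
  have h5 : (n : ℚ) + 1 ≠ 0 := by positivity
  have h6 : (n : ℚ) + 2 ≠ 0 := by positivity
  field_simp
  apply mul_left_cancel₀ h5
  linarith

theorem m1_eq (n : ℕ) : m 1 n = (3 * n) / (n + 2) * catalan n := by
  have h := m0_succ n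
  rw [m_zero, m_zero, catalan_step] at h
  have h6 : (n : ℚ) + 2 ≠ 0 := by positivity
  rw [← sub_eq_iff_eq_add] at h
  rw [← h]
  field_simp
  ring

theorem m2_eq (n : ℕ) : m 2 n =
    (2 * (3 * (n + 1)) / (n + 3) * (2 * (2 * n + 1) / (n + 2)) - 3 * ((3 * n) / (n + 2)) - 2)
      * catalan n := by
  have h := m1_succ n
  rw [m_zero, m1_eq, m1_eq, catalan_step] at h
  push_cast at h
  rw [show ((n : ℚ) + 1 + 2) = n + 3 by ring] at h
  linear_combination (-2) * h

theorem m3_eq (n : ℕ) : m 3 n =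
    3 * (2 * (3 * (n + 2)) / (n + 4) * (2 * (2 * n + 3) / (n + 3)) - 3 * ((3 * (n + 1)) / (n + 3))
      - 2) * (2 * (2 * n + 1) / (n + 2)) * catalan n
      - (9/2) * m 2 n - (13/2) * m 1 n - 3 * m 0 n := by
  have h := m2_succ n
  rw [m2_eq (n + 1), catalan_step] at h
  push_cast at h
  rw [show ((n : ℚ) + 1 + 2) = n + 3 by ring, show ((n : ℚ) + 1 + 3) = n + 4 by ring] at h
  linear_combination (-3) * h

theorem m4_eq (n : ℕ) : m 4 n = 4 * m 3 (n + 1)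
      - 6 * m 3 n - 13 * m 2 n - 12 * m 1 n - 4 * m 0 n := by
  linear_combination (-4) * m3_succ n

theorem m2_eq' (n : ℕ) : m 2 n = n * (13 * n - 1) / ((n + 2) * (n + 3)) * catalan n := by
  rw [m2_eq]
  have h6 : (n : ℚ) + 2 ≠ 0 := by positivity
  have h7 : (n : ℚ) + 3 ≠ 0 := by positivity
  field_simp
  ring

end BTree

theorem BTree.central (n k : ℕ) :
    (∑ᶠ T ∈ {T : BTree | T.V = n},
          ((T.JD : ℚ) - (n : ℚ) * ((n : ℚ) - 1) / ((n : ℚ) + 2)) ^ k) /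
        (Nat.card {T : BTree // T.V = n} : ℚ)
      = BTree.W n (fun d => (3 * (n : ℚ) / (n + 2) - d) ^ k) / catalan n := by
  have hset : {T : BTree | T.V = n} = ↑(BTree.trees n) := by
    ext T; simp [BTree.mem_trees]
  have hcard : Nat.card {T : BTree // T.V = n} = catalan n := by
    have : Nat.card {T : BTree // T.V = n} = Set.ncard {T : BTree | T.V = n} := rfl
    rw [this, hset, Set.ncard_coe_finset]
    simp [BTree.trees, BinaryTree.treesOfNumNodesEq_card_eq_catalan]
  rw [hcard, hset, finsum_mem_coe_finset, BTree.W]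
  congr 1
  apply Finset.sum_congr rfl
  intro T hT
  have h1 := (BTree.mem_trees n T).1 hT
  have h2 := BTree.JD_add_D T
  rw [h1] at h2
  have h3 : (T.JD : ℚ) + T.D = n := by exact_mod_cast h2
  congr 1
  have h6 : (n : ℚ) + 2 ≠ 0 := by positivity
  rw [← eq_sub_iff_add_eq] at h3
  rw [h3]
  field_simp
  ring

theorem BTree.W_two (n : ℕ) (a : ℚ) : BTree.W n (fun d => (a - d) ^ 2) =
    a ^ 2 * m 0 n + (-2 * a) * m 1 n + m 2 n := by
  simp only [m, ← W_add, ← W_mul]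
  congr 1; funext d; ring

theorem BTree.W_four (n : ℕ) (a : ℚ) : BTree.W n (fun d => (a - d) ^ 4) =
    a ^ 4 * m 0 n + (-4 * a ^ 3) * m 1 n + (6 * a ^ 2) * m 2 n + (-4 * a) * m 3 n + m 4 n := by
  simp only [m, ← W_add, ← W_mul]
  congr 1; funext d; ring


/-- The kurtosis of the sum-of-jump-distances statistic over full binary trees
with n ≥ 1 internal vertices:
2n·(2n⁴ + 17n³ + 30n² − 29n − 20)·ν₄ = (25n⁵ + 58n⁴ − 45n³ − 34n² − 172n − 48)·ν₂²,
where νₖ is the k-th central moment of JD about its mean n(n−1)/(n+2). -/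
theorem stmt_17 (n : ℕ) (hn : 1 ≤ n)
    (ν : ℕ → ℚ)
    (hν : ∀ k, ν k =
      (∑ᶠ T ∈ {T : BTree | T.V = n},
          ((T.JD : ℚ) - (n : ℚ) * ((n : ℚ) - 1) / ((n : ℚ) + 2)) ^ k) /
        (Nat.card {T : BTree // T.V = n} : ℚ)) :
    2 * (n : ℚ) * (2 * (n : ℚ) ^ 4 + 17 * n ^ 3 + 30 * n ^ 2 - 29 * n - 20) * ν 4 =
      (25 * (n : ℚ) ^ 5 + 58 * n ^ 4 - 45 * n ^ 3 - 34 * n ^ 2 - 172 * n - 48) * (ν 2) ^ 2 := by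
  have hc : (catalan n : ℚ) ≠ 0 := by
    have h := succ_mul_catalan_eq_centralBinom n
    have h' := Nat.centralBinom_pos n
    intro h0
    have : catalan n = 0 := by exact_mod_cast h0
    rw [this] at h
    omega
  have h2 : (n : ℚ) + 2 ≠ 0 := by positivity
  have h3 : (n : ℚ) + 3 ≠ 0 := by positivity
  have h4 : (n : ℚ) + 4 ≠ 0 := by positivity
  have h5 : (n : ℚ) + 5 ≠ 0 := by positivity
  rw [hν 4, hν 2, BTree.central, BTree.central, BTree.W_two, BTree.W_four, BTree.m4_eq,
    BTree.m3_eq, BTree.m3_eq, BTree.m2_eq', BTree.m2_eq', BTree.m1_eq, BTree.m1_eq,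
    BTree.m_zero, BTree.m_zero, BTree.catalan_step]
  push_cast
  rw [show ((n : ℚ) + 1 + 2) = n + 3 by ring, show ((n : ℚ) + 1 + 3) = n + 4 by ring,
    show ((n : ℚ) + 1 + 4) = n + 5 by ring]
  generalize (catalan n : ℚ) = c at *
  generalize (n : ℚ) = x at *
  field_simp
  ring
end
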